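/- Let K ≥ 1 and let Φ(1) ≤ ξ₁ < ξ₂ < … < ξ_{K+1} < 1 be a partition of a subinterval of [Φ(1), 1). For each k = 1, …, K define the secant coefficients u_k = (log Φ⁻¹(ξ_{k+1}) − log Φ⁻¹(ξ_k)) / (ξ_{k+1} − ξ_k) and t_k = (ξ_{k+1} · log Φ⁻¹(ξ_k) − ξ_k · log Φ⁻¹(ξ_{k+1})) / (ξ_{k+1} − ξ_k). Then for every z ∈ [ξ₁, ξ_{K+1}], log Φ⁻¹(z) ≤ max_{k=1,…,K} (u_k · z + t_k). -/

import Mathlib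

open MeasureTheory ProbabilityTheory

/-- `Φ`, the cumulative distribution function of the standard Gaussian
distribution `N(0,1)` on `ℝ`. -/
noncomputable def stdGaussianCDF (t : ℝ) : ℝ :=
  (ProbabilityTheory.gaussianReal 0 1 (Set.Iic t)).toReal

/-- `Φ⁻¹`, the standard Gaussian quantile function (the inverse of `Φ` on `(0,1)`). -/
noncomputable def stdGaussianQuantile : ℝ → ℝ :=
  Function.invFun stdGaussianCDF

lemma hasDerivAt_stdGaussianCDF (x : ℝ) :
    HasDerivAt stdGaussianCDF (gaussianPDFReal 0 1 x) x := by
  have hint := integrable_gaussianPDFReal 0 1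
  have hcont : Continuous (gaussianPDFReal 0 1) := by
    unfold gaussianPDFReal
    fun_prop
  have hCDF (y : ℝ) : stdGaussianCDF y = ∫ a in Set.Iic y, gaussianPDFReal 0 1 a := by
    rw [stdGaussianCDF, gaussianReal_apply_eq_integral 0 one_ne_zero, ENNReal.toReal_ofReal]
    exact integral_nonneg (gaussianPDFReal_nonneg 0 1)
  have heq : stdGaussianCDF =
      fun y ↦ stdGaussianCDF 0 + ∫ a in (0 : ℝ)..y, gaussianPDFReal 0 1 a := by
    ext y
    rw [← intervalIntegral.integral_Iic_sub_Iic hint.integrableOn hint.integrableOn, hCDF, hCDF]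
    ring
  rw [heq]
  exact (intervalIntegral.integral_hasDerivAt_right (hcont.intervalIntegrable _ _)
    (hcont.stronglyMeasurableAtFilter _ _) hcont.continuousAt).const_add _

lemma strictMono_stdGaussianCDF : StrictMono stdGaussianCDF :=
  strictMono_of_deriv_pos fun x ↦ by
    rw [(hasDerivAt_stdGaussianCDF x).deriv]
    exact gaussianPDFReal_pos 0 1 x one_ne_zero

lemma continuous_stdGaussianCDF : Continuous stdGaussianCDF :=
  continuous_iff_continuousAt.2 fun x ↦ (hasDerivAt_stdGaussianCDF x).continuousAt

lemma stdGaussianCDF_eq_cdf : stdGaussianCDF = cdf (gaussianReal 0 1) := by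
  ext x
  rw [cdf_eq_real]
  rfl

/-- `Φ` is onto `(0,1)`, so that `Φ (Φ⁻¹ z) = z` there. -/
lemma stdGaussianCDF_stdGaussianQuantile {z : ℝ} (h0 : 0 < z) (h1 : z < 1) :
    stdGaussianCDF (stdGaussianQuantile z) = z := by
  apply Function.invFun_eq
  have hbot := tendsto_cdf_atBot (gaussianReal 0 1)
  have htop := tendsto_cdf_atTop (gaussianReal 0 1)
  rw [← stdGaussianCDF_eq_cdf] at hbot htop
  exact mem_range_of_exists_le_of_exists_ge continuous_stdGaussianCDF
    ((hbot.eventually_le_const h0).exists) ((htop.eventually_const_le h1).exists)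

lemma stdGaussianCDF_pos (x : ℝ) : 0 < stdGaussianCDF x :=
  lt_of_le_of_lt ENNReal.toReal_nonneg (strictMono_stdGaussianCDF (sub_one_lt x))

/-- `Φ ∘ exp` is concave on `[0, ∞)`, since `y ↦ y * φ y` decreases on `[1, ∞)`. -/
lemma concaveOn_stdGaussianCDF_comp_exp :
    ConcaveOn ℝ (Set.Ici 0) (fun s ↦ stdGaussianCDF (Real.exp s)) := by
  have hderiv (s : ℝ) : HasDerivAt (fun s ↦ stdGaussianCDF (Real.exp s))
      (gaussianPDFReal 0 1 (Real.exp s) * Real.exp s) s :=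
    (hasDerivAt_stdGaussianCDF _).comp s (Real.hasDerivAt_exp s)
  have hdiff : Differentiable ℝ (fun s ↦ stdGaussianCDF (Real.exp s)) :=
    fun s ↦ (hderiv s).differentiableAt
  refine AntitoneOn.concaveOn_of_deriv (convex_Ici 0) hdiff.continuous.continuousOn
    hdiff.differentiableOn ?_
  intro s hs t ht hst
  rw [interior_Ici] at hs
  rw [(hderiv s).deriv, (hderiv t).deriv]
  simp only [gaussianPDFReal, mul_assoc, ← Real.exp_add]
  refine mul_le_mul_of_nonneg_left (Real.exp_le_exp.2 ?_) (by positivity)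
  have hs1 : 1 ≤ Real.exp s := Real.one_le_exp hs.le
  have hgrow : (t - s + 1) * Real.exp s ≤ Real.exp t := by
    calc (t - s + 1) * Real.exp s ≤ Real.exp (t - s) * Real.exp s := by
          gcongr
          exact Real.add_one_le_exp _
      _ = Real.exp t := by rw [← Real.exp_add, sub_add_cancel]
  have hsub : t - s ≤ Real.exp t - Real.exp s := by
    nlinarith [mul_nonneg (sub_nonneg.2 hst) (sub_nonneg.2 hs1)]
  have hadd : 2 ≤ Real.exp t + Real.exp s := by
    linarith [Real.exp_le_exp.2 hst]
  have hsq : (t - s) * 2 ≤ (Real.exp t - Real.exp s) * (Real.exp t + Real.exp s) :=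
    mul_le_mul hsub hadd zero_le_two ((sub_nonneg.2 hst).trans hsub)
  norm_num
  linarith

lemma one_le_stdGaussianQuantile {z : ℝ} (hz : z ∈ Set.Ico (stdGaussianCDF 1) 1) :
    1 ≤ stdGaussianQuantile z := by
  rw [← strictMono_stdGaussianCDF.le_iff_le,
    stdGaussianCDF_stdGaussianQuantile ((stdGaussianCDF_pos 1).trans_le hz.1) hz.2]
  exact hz.1

lemma convexOn_log_stdGaussianQuantile :
    ConvexOn ℝ (Set.Ico (stdGaussianCDF 1) 1) (fun z ↦ Real.log (stdGaussianQuantile z)) := by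
  have hinv {z : ℝ} (hz : z ∈ Set.Ico (stdGaussianCDF 1) 1) :
      stdGaussianCDF (Real.exp (Real.log (stdGaussianQuantile z))) = z := by
    rw [Real.exp_log (zero_lt_one.trans_le (one_le_stdGaussianQuantile hz)),
      stdGaussianCDF_stdGaussianQuantile ((stdGaussianCDF_pos 1).trans_le hz.1) hz.2]
  refine ⟨convex_Ico _ _, fun x hx y hy a b ha hb hab ↦ ?_⟩
  have hconc := concaveOn_stdGaussianCDF_comp_exp.2
    (Real.log_nonneg (one_le_stdGaussianQuantile hx))
    (Real.log_nonneg (one_le_stdGaussianQuantile hy)) ha hb hab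
  simp only [hinv hx, hinv hy] at hconc
  rw [← (strictMono_stdGaussianCDF.comp Real.exp_strictMono).le_iff_le]
  exact (hinv (convex_Ico _ _ hx hy ha hb hab)).trans_le hconc

lemma ConvexOn.le_secant {s : Set ℝ} {f : ℝ → ℝ} (hf : ConvexOn ℝ s f) {x y z : ℝ}
    (hx : x ∈ s) (hy : y ∈ s) (hxy : x < y) (hz : z ∈ Set.Icc x y) :
    f z ≤ (f y - f x) / (y - x) * z + (y * f x - x * f y) / (y - x) := by
  have hpos : 0 < y - x := sub_pos.2 hxy
  have h := hf.2 hx hy (div_nonneg (sub_nonneg.2 hz.2) hpos.le)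
    (div_nonneg (sub_nonneg.2 hz.1) hpos.le) (by field_simp; ring)
  simp only [smul_eq_mul] at h
  have hcomb : (y - z) / (y - x) * x + (z - x) / (y - x) * y = z := by field_simp; ring
  rw [hcomb] at h
  refine h.trans_eq ?_
  field_simp
  ring

/-- Consecutive intervals of a finite sequence cover the interval between its endpoints. -/
lemma Fin.exists_mem_Icc_castSucc_succ {α : Type*} [LinearOrder α] {K : ℕ} (hK : 1 ≤ K)
    (ξ : Fin (K + 1) → α) {z : α} (hz : z ∈ Set.Icc (ξ 0) (ξ (Fin.last K))) :
    ∃ k : Fin K, z ∈ Set.Icc (ξ k.castSucc) (ξ k.succ) := by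
  by_contra! h
  have hle (i : Fin (K + 1)) : ξ i ≤ z := by
    induction i using Fin.induction with
    | zero => exact hz.1
    | succ i ih => exact (not_le.1 fun hi ↦ h i ⟨ih, hi⟩).le
  obtain ⟨n, rfl⟩ := Nat.exists_eq_add_of_le' hK
  exact h (Fin.last n) ⟨hle _, hz.2⟩

theorem stmt_10 (K : ℕ) (hK : 1 ≤ K) (ξ : Fin (K + 1) → ℝ) (hmono : StrictMono ξ)
    (hlo : stdGaussianCDF 1 ≤ ξ 0) (hhi : ξ (Fin.last K) < 1)
    (u t : Fin K → ℝ)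
    (hu : ∀ k, u k = (Real.log (stdGaussianQuantile (ξ k.succ)) -
        Real.log (stdGaussianQuantile (ξ k.castSucc))) / (ξ k.succ - ξ k.castSucc))
    (ht : ∀ k, t k = (ξ k.succ * Real.log (stdGaussianQuantile (ξ k.castSucc)) -
        ξ k.castSucc * Real.log (stdGaussianQuantile (ξ k.succ))) / (ξ k.succ - ξ k.castSucc)) :
    ∀ z ∈ Set.Icc (ξ 0) (ξ (Fin.last K)),
      ∃ k : Fin K, Real.log (stdGaussianQuantile z) ≤ u k * z + t k := by
  intro z hz
  obtain ⟨k, hk⟩ := Fin.exists_mem_Icc_castSucc_succ hK ξ hz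
  have hmem (i : Fin (K + 1)) : ξ i ∈ Set.Ico (stdGaussianCDF 1) 1 :=
    ⟨hlo.trans (hmono.monotone (Fin.zero_le i)), (hmono.monotone (Fin.le_last i)).trans_lt hhi⟩
  refine ⟨k, ?_⟩
  rw [hu, ht]
  exact convexOn_log_stdGaussianQuantile.le_secant (hmem _) (hmem _)
    (hmono k.castSucc_lt_succ) hk
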